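/- arXiv:1409.5868 — 3 statements merged into one kernel-verified Lean document; each statement's English description precedes it below -/
import Mathlib

section
/- Let n be a positive integer, m = ⌊n/2⌋, and let w be a permutation of {1,…,n}. Then the Schubert variety S_w contains an isotropic complete flag and ℓ(w) = m² (in case n = 2m), respectively ℓ(w) = m² + m (in case n = 2m+1), if and only if w satisfies the double box contraction condition. -/
noncomputable section

/-- `stdE n j` is the span `E_j` of the first `j` standard basis vectors of `ℂ^n`. -/
def stdE (n j : ℕ) : Submodule ℂ (Fin n → ℂ) :=
  Submodule.span ℂ ((fun i : Fin n => (Pi.single i 1 : Fin n → ℂ)) '' {i : Fin n | (i : ℕ) < j})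

/-- The number of inversions (length `ℓ(w)`) of a permutation of `{1,…,n}`. -/
def invCount (n : ℕ) (w : Equiv.Perm (Fin n)) : ℕ :=
  (Finset.univ.filter (fun p : Fin n × Fin n => p.1 < p.2 ∧ w p.2 < w p.1)).card

/-- The image `τ(V)` of a complex subspace `V ⊆ ℂ^n` under coordinatewise complex
conjugation (equivalently, its preimage, since conjugation is an involution). -/
def conjSubmodule (n : ℕ) (V : Submodule ℂ (Fin n → ℂ)) : Submodule ℂ (Fin n → ℂ) where
  carrier := {x | (fun i => (starRingEnd ℂ) (x i)) ∈ V}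
  add_mem' := by
    intro a b ha hb
    simp only [Set.mem_setOf_eq] at *
    have h : (fun i => (starRingEnd ℂ) ((a + b) i))
        = (fun i => (starRingEnd ℂ) (a i)) + fun i => (starRingEnd ℂ) (b i) := by
      funext i; simp
    rw [h]; exact V.add_mem ha hb
  zero_mem' := by
    simp only [Set.mem_setOf_eq]
    have h : (fun i => (starRingEnd ℂ) ((0 : Fin n → ℂ) i)) = (0 : Fin n → ℂ) := by
      funext i; simp
    rw [h]; exact V.zero_mem
  smul_mem' := by
    intro c x hx
    simp only [Set.mem_setOf_eq] at *
    have h : (fun i => (starRingEnd ℂ) ((c • x) i))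
        = (starRingEnd ℂ) c • fun i => (starRingEnd ℂ) (x i) := by
      funext i; simp
    rw [h]; exact V.smul_mem _ hx

/-- The orthogonal complement `V^⊥` of a subspace of `ℂ^n` with respect to the standard
symmetric bilinear form `b(v,w) = Σ v i * w i`. -/
def bOrtho (n : ℕ) (V : Submodule ℂ (Fin n → ℂ)) : Submodule ℂ (Fin n → ℂ) where
  carrier := {x | ∀ v ∈ V, ∑ i, x i * v i = 0}
  add_mem' := by
    intro a b ha hb v hv
    simp only [Pi.add_apply, add_mul]
    rw [Finset.sum_add_distrib, ha v hv, hb v hv, add_zero]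
  zero_mem' := by intro v hv; simp
  smul_mem' := by
    intro c x hx v hv
    simp only [Pi.smul_apply, smul_eq_mul, mul_assoc]
    rw [← Finset.mul_sum, hx v hv, mul_zero]

/-- A complete flag `0 = V_0 ⊂ V_1 ⊂ ⋯ ⊂ V_n = ℂ^n` in `ℂ^n`, with `dim V_i = i`. -/
structure CompleteFlag (n : ℕ) where
  V : Fin (n + 1) → Submodule ℂ (Fin n → ℂ)
  mono : Monotone V
  dim : ∀ i : Fin (n + 1), Module.finrank ℂ (V i) = (i : ℕ)

/-- Membership of a complete flag in the Schubert variety `S_w`: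
`dim (V_i ∩ E_j) ≥ #{a : 1 ≤ a ≤ i, w(a) ≤ j}` for all `1 ≤ i, j ≤ n`. -/
def InSchubert (n : ℕ) (w : Equiv.Perm (Fin n)) (F : CompleteFlag n) : Prop :=
  ∀ i j : ℕ, 1 ≤ i → i ≤ n → 1 ≤ j → j ≤ n → ∀ hi : i < n + 1,
    (Finset.univ.filter (fun a : Fin n => (a : ℕ) < i ∧ ((w a : ℕ)) < j)).card
      ≤ Module.finrank ℂ ↥(F.V ⟨i, hi⟩ ⊓ stdE n j)

/-- A complete flag is `τ`-generic if `τ(V_j) ⊕ V_{n-j} = ℂ^n` for all `1 ≤ j ≤ ⌊n/2⌋`. -/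
def TauGeneric (n : ℕ) (F : CompleteFlag n) : Prop :=
  ∀ j : ℕ, 1 ≤ j → j ≤ n / 2 → ∀ (h1 : j < n + 1) (h2 : n - j < n + 1),
    IsCompl (conjSubmodule n (F.V ⟨j, h1⟩)) (F.V ⟨n - j, h2⟩)

/-- A complete flag is isotropic if `V_{n-i} = (V_i)^⊥` for all `1 ≤ i ≤ ⌊n/2⌋`. -/
def IsotropicFlag (n : ℕ) (F : CompleteFlag n) : Prop :=
  ∀ i : ℕ, 1 ≤ i → i ≤ n / 2 → ∀ (h1 : n - i < n + 1) (h2 : i < n + 1),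
    F.V ⟨n - i, h1⟩ = bOrtho n (F.V ⟨i, h2⟩)

/-- The spacing condition: `w(n+1-i) < w(i)` for all `1 ≤ i ≤ ⌊n/2⌋` (one-line notation,
positions and values written here `0`-based via `Fin n`). -/
def Spacing (n : ℕ) (w : Equiv.Perm (Fin n)) : Prop :=
  ∀ i : ℕ, 1 ≤ i → i ≤ n / 2 → ∀ (h1 : n - i < n) (h2 : i - 1 < n),
    (w ⟨n - i, h1⟩ : Fin n) < w ⟨i - 1, h2⟩

/-- The double box contraction condition: for every `1 ≤ i ≤ ⌊n/2⌋`, `w(n+1-i) < w(i)` and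
every value `x` strictly between `w(n+1-i)` and `w(i)` equals `w(a)` or `w(n+1-a)` for some
`1 ≤ a ≤ i-1`. -/
def DoubleBox (n : ℕ) (w : Equiv.Perm (Fin n)) : Prop :=
  ∀ i : ℕ, 1 ≤ i → i ≤ n / 2 → ∀ (h1 : n - i < n) (h2 : i - 1 < n),
    (w ⟨n - i, h1⟩ : ℕ) < (w ⟨i - 1, h2⟩ : ℕ) ∧
    ∀ x : ℕ, (w ⟨n - i, h1⟩ : ℕ) < x → x < (w ⟨i - 1, h2⟩ : ℕ) →
      ∃ a : ℕ, 1 ≤ a ∧ a ≤ i - 1 ∧ ∀ (ha1 : a - 1 < n) (ha2 : n - a < n),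
        x = (w ⟨a - 1, ha1⟩ : ℕ) ∨ x = (w ⟨n - a, ha2⟩ : ℕ)

/-- A partial flag `0 = V_0 ⊂ V_1 ⊂ ⋯ ⊂ V_r = ℂ^n` with `r` steps (the dimensions are
prescribed separately, via `OfType`). -/
structure PartialFlag (n r : ℕ) where
  V : Fin (r + 1) → Submodule ℂ (Fin n → ℂ)
  mono : Monotone V

/-- A partial flag is of type `f` (with partial sums `δ`) if `dim V_i = δ_i` for all `i`. -/
def OfType (n r : ℕ) (δ : ℕ → ℕ) (F : PartialFlag n r) : Prop :=
  ∀ i : Fin (r + 1), Module.finrank ℂ (F.V i) = δ (i : ℕ)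

/-- `w` is a minimal coset representative for the dimension sequence with partial sums `δ`:
it is increasing on each block of positions `δ_{i-1}+1, …, δ_i`. -/
def MinimalRep (n r : ℕ) (δ : ℕ → ℕ) (w : Equiv.Perm (Fin n)) : Prop :=
  ∀ i a b : ℕ, 1 ≤ i → i ≤ r → δ (i - 1) < a → a < b → b ≤ δ i →
    ∀ (ha : a - 1 < n) (hb : b - 1 < n), (w ⟨a - 1, ha⟩ : Fin n) < w ⟨b - 1, hb⟩

/-- Membership of a partial flag in the Schubert variety `S_w` of the partial flag manifold:
`dim (V_i ∩ E_j) ≥ #{a : 1 ≤ a ≤ δ_i, w(a) ≤ j}` for all `i` and all `1 ≤ j ≤ n`. -/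
def InSchubertP (n r : ℕ) (δ : ℕ → ℕ) (w : Equiv.Perm (Fin n)) (F : PartialFlag n r) : Prop :=
  ∀ (i : Fin (r + 1)) (j : ℕ), 1 ≤ j → j ≤ n →
    (Finset.univ.filter (fun a : Fin n => (a : ℕ) < δ (i : ℕ) ∧ ((w a : ℕ)) < j)).card
      ≤ Module.finrank ℂ ↥(F.V i ⊓ stdE n j)

/-- A partial flag of type `f` (partial sums `δ`) is isotropic if
`dim (V_i ∩ (V_j)^⊥) = min (δ_i, n - δ_j)` for all `1 ≤ i, j ≤ r`. -/
def IsotropicP (n r : ℕ) (δ : ℕ → ℕ) (F : PartialFlag n r) : Prop :=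
  ∀ i j : Fin (r + 1), 1 ≤ (i : ℕ) → 1 ≤ (j : ℕ) →
    Module.finrank ℂ ↥(F.V i ⊓ bOrtho n (F.V j)) = min (δ (i : ℕ)) (n - δ (j : ℕ))

/-- A partial flag of type `f` (partial sums `δ`) is `τ`-generic if
`dim (V_i ∩ τ(V_j)) = max (0, δ_i + δ_j - n)` for all `1 ≤ i, j ≤ r`
(truncated subtraction on `ℕ` realizes the `max` with `0`). -/
def TauGenericP (n r : ℕ) (δ : ℕ → ℕ) (F : PartialFlag n r) : Prop :=
  ∀ i j : Fin (r + 1), 1 ≤ (i : ℕ) → 1 ≤ (j : ℕ) →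
    Module.finrank ℂ ↥(F.V i ⊓ conjSubmodule n (F.V j)) = δ (i : ℕ) + δ (j : ℕ) - n

/-- The generalized spacing condition for a symmetric dimension sequence `f` with `r` blocks
and partial sums `δ`: for each `1 ≤ j ≤ ⌊r/2⌋` there is a bijection `φ` of `{1,…,f_j}`
with `w(δ_{r-j} + φ(i)) < w(δ_{j-1} + i)` for all `i`. -/
def GenSpacing (n r : ℕ) (f δ : ℕ → ℕ) (w : Equiv.Perm (Fin n)) : Prop :=
  ∀ j : ℕ, 1 ≤ j → j ≤ r / 2 →
    ∃ φ : Equiv.Perm (Fin (f j)), ∀ i : Fin (f j),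
      ∀ (h1 : δ (r - j) + (φ i : ℕ) < n) (h2 : δ (j - 1) + (i : ℕ) < n),
        (w ⟨δ (r - j) + (φ i : ℕ), h1⟩ : Fin n) < w ⟨δ (j - 1) + (i : ℕ), h2⟩

/-- The generalized double box contraction condition for a symmetric dimension sequence
built from `d = (d_1,…,d_s)` (with `r` blocks in total and partial sums `δ`): there are
pairwise distinct numbers `k_i^j, l_i^j ∈ {1,…,n}` such that block `j` of `w` consists of the
`k_i^j`, block `r+1-j` consists of the `l_i^j`, `l_i^j < k_i^j`, and every number strictly
between `l_i^j` and `k_i^j` belongs to an earlier block pair. (Values are `1`-based here.) -/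
def GenDoubleBox (n s r : ℕ) (d δ : ℕ → ℕ) (w : Equiv.Perm (Fin n)) : Prop :=
  ∃ k l : ℕ → ℕ → ℕ,
    (∀ j i, 1 ≤ j → j ≤ s → 1 ≤ i → i ≤ d j →
      1 ≤ k j i ∧ k j i ≤ n ∧ 1 ≤ l j i ∧ l j i ≤ n) ∧
    (∀ j i j' i', 1 ≤ j → j ≤ s → 1 ≤ i → i ≤ d j → 1 ≤ j' → j' ≤ s → 1 ≤ i' → i' ≤ d j' →
      (k j i = k j' i' → j = j' ∧ i = i') ∧
      (l j i = l j' i' → j = j' ∧ i = i') ∧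
      k j i ≠ l j' i') ∧
    (∀ j a, 1 ≤ j → j ≤ s → δ (j - 1) < a → a ≤ δ j →
      ∀ ha : a - 1 < n, ∃ i, 1 ≤ i ∧ i ≤ d j ∧ (w ⟨a - 1, ha⟩ : ℕ) + 1 = k j i) ∧
    (∀ j a, 1 ≤ j → j ≤ s → δ (r - j) < a → a ≤ δ (r + 1 - j) →
      ∀ ha : a - 1 < n, ∃ i, 1 ≤ i ∧ i ≤ d j ∧ (w ⟨a - 1, ha⟩ : ℕ) + 1 = l j i) ∧
    (∀ j i, 1 ≤ j → j ≤ s → 1 ≤ i → i ≤ d j →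
      l j i < k j i ∧
      ∀ x : ℕ, l j i < x → x < k j i →
        ∃ j' i', 1 ≤ j' ∧ j' < j ∧ 1 ≤ i' ∧ i' ≤ d j' ∧ (x = k j' i' ∨ x = l j' i'))

/-- The ordered basis `(u_1,…,u_n)` of intersection points: for `1 ≤ j ≤ ⌊n/2⌋`,
`u_j = ε_j • 𝐢 • e_{w(n+1-j)} + e_{w(j)}`, and `u_j = e_{w(j)}` for `⌊n/2⌋ < j ≤ n`
(this covers both the middle vector `e_{l_*}` and the vectors `u_{n+1-j} = e_{l_j}`). -/
def uVec (n : ℕ) (w : Equiv.Perm (Fin n)) (ε : ℕ → ℂ) (j : ℕ) : Fin n → ℂ :=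
  if h : 1 ≤ j ∧ j ≤ n then
    if j ≤ n / 2 then
      (ε j * Complex.I) • (Pi.single (w ⟨n - j, by omega⟩) (1 : ℂ) : Fin n → ℂ)
        + Pi.single (w ⟨j - 1, by omega⟩) (1 : ℂ)
    else Pi.single (w ⟨j - 1, by omega⟩) (1 : ℂ)
  else 0


/-- The standard symmetric bilinear form on `ℂ^n`. -/
def stdForm (n : ℕ) : LinearMap.BilinForm ℂ (Fin n → ℂ) := Matrix.toBilin' 1

lemma stdForm_apply (n : ℕ) (x y : Fin n → ℂ) : stdForm n x y = ∑ i, x i * y i := by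
  simp [stdForm, Matrix.toBilin'_apply', dotProduct]

lemma bOrtho_eq_orthogonal (n : ℕ) (V : Submodule ℂ (Fin n → ℂ)) :
    bOrtho n V = (stdForm n).orthogonal V := by
  ext x
  simp only [LinearMap.BilinForm.mem_orthogonal_iff, stdForm_apply]
  simp only [mul_comm]
  rfl

lemma finrank_bOrtho (n : ℕ) (V : Submodule ℂ (Fin n → ℂ)) :
    Module.finrank ℂ (bOrtho n V) = n - Module.finrank ℂ V := by
  have hB : (stdForm n).Nondegenerate := by
    exact LinearMap.BilinForm.nondegenerate_toBilin'_of_det_ne_zero' _ (by simp)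
  rw [bOrtho_eq_orthogonal, LinearMap.BilinForm.finrank_orthogonal hB]
  simp

lemma mem_bOrtho_span {n : ℕ} {s : Set (Fin n → ℂ)} {x : Fin n → ℂ}
    (h : ∀ v ∈ s, ∑ i, x i * v i = 0) : x ∈ bOrtho n (Submodule.span ℂ s) := by
  intro v hv
  induction hv using Submodule.span_induction with
  | mem v hv => exact h v hv
  | zero => simp
  | add a b _ _ ha hb => simp [mul_add, Finset.sum_add_distrib, ha, hb]
  | smul c a _ ha =>
    have : ∀ i, x i * (c • a) i = c * (x i * a i) := fun i => by simp; ring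
    simp_rw [this, ← Finset.mul_sum, ha, mul_zero]

lemma single_mem_stdE {n j : ℕ} {i : Fin n} (h : (i : ℕ) < j) :
    (Pi.single i 1 : Fin n → ℂ) ∈ stdE n j :=
  Submodule.subset_span ⟨i, h, rfl⟩

lemma apply_eq_zero_of_mem_stdE {n j : ℕ} {x : Fin n → ℂ} (hx : x ∈ stdE n j) {i : Fin n}
    (hi : j ≤ (i : ℕ)) : x i = 0 := by
  have : stdE n j ≤ LinearMap.ker (LinearMap.proj i : (Fin n → ℂ) →ₗ[ℂ] ℂ) := by
    refine Submodule.span_le.2 ?_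
    rintro _ ⟨a, ha, rfl⟩
    have : i ≠ a := by rintro rfl; exact absurd ha (by simp; omega)
    simp [this]
  simpa using this hx

lemma finrank_stdE_le (n j : ℕ) : Module.finrank ℂ (stdE n j) ≤ j := by
  classical
  have hs : stdE n j = Submodule.span ℂ (((Finset.univ.filter (fun i : Fin n => (i : ℕ) < j)).image
      (fun i : Fin n => (Pi.single i 1 : Fin n → ℂ)) : Finset (Fin n → ℂ)) : Set (Fin n → ℂ)) := by
    simp [stdE]
  rw [hs]
  refine (finrank_span_finset_le_card _).trans (Finset.card_image_le.trans ?_)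
  rw [Fin.card_filter_val_lt]
  exact min_le_right _ _

/-- In `E_j`, on which the form is nondegenerate, mutually orthogonal subspaces have total
dimension at most `j`. -/
lemma finrank_inf_stdE_add_le {n : ℕ} (V : Submodule ℂ (Fin n → ℂ)) {j : ℕ} (hj : j ≤ n) :
    Module.finrank ℂ ↥(V ⊓ stdE n j) + Module.finrank ℂ ↥(bOrtho n V ⊓ stdE n j) ≤ j := by
  have hdis : (bOrtho n V ⊓ stdE n j) ⊓ bOrtho n (stdE n j) = ⊥ := by
    rw [eq_bot_iff]
    rintro x ⟨⟨-, hx⟩, hx'⟩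
    rw [Submodule.mem_bot]
    funext i
    by_cases hi : (i : ℕ) < j
    · have := hx' _ (single_mem_stdE hi)
      simpa [Pi.single_apply] using this
    · exact apply_eq_zero_of_mem_stdE hx (not_lt.1 hi)
  have hle : (bOrtho n V ⊓ stdE n j) ⊔ bOrtho n (stdE n j) ≤ bOrtho n (V ⊓ stdE n j) :=
    sup_le (fun x hx v hv => hx.1 v hv.1) (fun x hx v hv => hx v hv.2)
  have h1 := Submodule.finrank_sup_add_finrank_inf_eq (bOrtho n V ⊓ stdE n j)
    (bOrtho n (stdE n j))
  have h2 := Submodule.finrank_mono hle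
  rw [hdis, finrank_bot, finrank_bOrtho] at h1
  rw [finrank_bOrtho] at h2
  have h3 := finrank_stdE_le n j
  have h4 := Submodule.finrank_le (V ⊓ stdE n j)
  simp only [Module.finrank_fin_fun] at h4
  omega

/-- A basis of `ℂ^n` whose first vectors span an isotropic flag. -/
def isoVec {n : ℕ} (w : Equiv.Perm (Fin n)) (a : Fin n) : Fin n → ℂ :=
  if a < a.rev then Complex.I • (Pi.single (w a.rev) 1 : Fin n → ℂ) + Pi.single (w a) 1
  else Pi.single (w a) 1

lemma isoVec_linearIndependent {n : ℕ} (w : Equiv.Perm (Fin n)) :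
    LinearIndependent ℂ (isoVec w) := by
  refine linearIndependent_of_top_le_span_of_card_eq_finrank ?_ (by simp)
  have hmem : ∀ a, isoVec w a ∈ Submodule.span ℂ (Set.range (isoVec w)) :=
    fun a => Submodule.subset_span ⟨a, rfl⟩
  have hsingle : ∀ a, (Pi.single (w a) 1 : Fin n → ℂ) ∈
      Submodule.span ℂ (Set.range (isoVec w)) := by
    intro a
    by_cases ha : a < a.rev
    · have h := Submodule.sub_mem _ (hmem a) (Submodule.smul_mem _ Complex.I (hmem a.rev))
      simpa [isoVec, ha, ha.le, ha.not_gt] using h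
    · simpa [isoVec, ha] using hmem a
  intro x _
  rw [pi_eq_sum_univ' x]
  refine Submodule.sum_mem _ fun i _ => Submodule.smul_mem _ _ ?_
  have h := hsingle (w.symm i)
  rw [Equiv.apply_symm_apply] at h
  convert h using 1

lemma finrank_span_isoVec {n : ℕ} (w : Equiv.Perm (Fin n)) (p : Fin n → Prop) [DecidablePred p] :
    Module.finrank ℂ (Submodule.span ℂ (isoVec w '' {a | p a})) =
      (Finset.univ.filter p).card := by
  classical
  have h := (isoVec_linearIndependent w).comp (fun a : {a // p a} => (a : Fin n))
    Subtype.val_injective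
  have h' := finrank_span_eq_card h
  rw [Set.range_comp, Subtype.range_coe_subtype] at h'
  rw [h', Fintype.card_subtype]

/-- The flag spanned by the vectors `isoVec w`. -/
def isoFlag {n : ℕ} (w : Equiv.Perm (Fin n)) : CompleteFlag n where
  V i := Submodule.span ℂ (isoVec w '' {a : Fin n | (a : ℕ) < (i : ℕ)})
  mono i j hij := Submodule.span_mono (Set.image_mono fun a (ha : (a : ℕ) < i) =>
    lt_of_lt_of_le ha hij)
  dim i := by
    rw [finrank_span_isoVec w (fun a => (a : ℕ) < (i : ℕ)), Fin.card_filter_val_lt]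
    omega

lemma isoFlag_inSchubert {n : ℕ} {w : Equiv.Perm (Fin n)}
    (hw : ∀ a : Fin n, a < a.rev → w a.rev < w a) : InSchubert n w (isoFlag w) := by
  intro i j _ _ _ _ hi
  rw [← finrank_span_isoVec w (fun a => (a : ℕ) < i ∧ (w a : ℕ) < j)]
  refine Submodule.finrank_mono (le_inf (Submodule.span_mono (Set.image_mono fun a ha => ha.1)) ?_)
  refine Submodule.span_le.2 ?_
  rintro _ ⟨a, ⟨-, ha⟩, rfl⟩
  by_cases h : a < a.rev
  · have h2 : (w a.rev : ℕ) < j := lt_trans (hw a h) ha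
    simpa [isoVec, h] using Submodule.add_mem _
      (Submodule.smul_mem _ Complex.I (single_mem_stdE h2)) (single_mem_stdE ha)
  · simpa [isoVec, h] using single_mem_stdE ha

lemma isoVec_orthogonal {n : ℕ} (w : Equiv.Perm (Fin n)) {a b : Fin n} (hb : b < b.rev)
    (hab : a < b.rev) : ∑ i, isoVec w a i * isoVec w b i = 0 := by
  have hne : a ≠ b.rev := hab.ne
  have hne' : a.rev ≠ b := fun h => hne (by rw [← h, Fin.rev_rev])
  have hbb : b ≠ b.rev := hb.ne
  rcases eq_or_ne a b with rfl | h
  · simp [isoVec, hb, Pi.single_apply, mul_add, add_mul, Finset.sum_add_distrib, hbb, hbb.symm]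
  · have h' : a.rev ≠ b.rev := fun e => h (Fin.rev_injective e)
    by_cases ha : a < a.rev <;>
    simp [isoVec, hb, ha, Pi.single_apply, mul_add, add_mul, Finset.sum_add_distrib, h.symm,
      hne.symm, hne'.symm]

lemma isoFlag_isotropic {n : ℕ} (w : Equiv.Perm (Fin n)) : IsotropicFlag n (isoFlag w) := by
  intro i _ him h1 h2
  refine Submodule.eq_of_le_of_finrank_eq ?_ ?_
  · refine Submodule.span_le.2 ?_
    rintro _ ⟨a, ha, rfl⟩
    refine mem_bOrtho_span ?_
    rintro _ ⟨b, hb, rfl⟩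
    simp only [Set.mem_ofPred_eq] at ha hb
    apply isoVec_orthogonal
    · rw [Fin.lt_def, Fin.val_rev]; omega
    · rw [Fin.lt_def, Fin.val_rev]; omega
  · rw [finrank_bOrtho, (isoFlag w).dim, (isoFlag w).dim]

/-- The contribution of the shell `{i, n-1-i}` to the excess of lower over upper values
below the threshold `j`. -/
def shellExcess {n : ℕ} (w : Equiv.Perm (Fin n)) (i : Fin n) (j : ℕ) : ℤ :=
  (if (w i.rev : ℕ) < j then 1 else 0) - (if (w i : ℕ) < j then 1 else 0)

/-- The total excess of the `s` outermost shells below the threshold `j`. -/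
def outerExcess {n : ℕ} (w : Equiv.Perm (Fin n)) (s j : ℕ) : ℤ :=
  ∑ i : Fin n, if (i : ℕ) < s then shellExcess w i j else 0

/-- The excess, below the value `w b`, of the shells strictly outside the shell of `b`. -/
def positionExcess {n : ℕ} (w : Equiv.Perm (Fin n)) (b : Fin n) : ℤ :=
  outerExcess w (min (b : ℕ) (b.rev : ℕ)) (w b)

/-- The contribution of the shell of `b` to `ℓ(w) - m(n-m)`. -/
def lengthExcess {n : ℕ} (w : Equiv.Perm (Fin n)) (b : Fin n) : ℤ :=
  if b < b.rev then positionExcess w b + positionExcess w b.rev - (if w b < w b.rev then 1 else 0)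
  else if b = b.rev then positionExcess w b else 0

lemma outerExcess_succ {n : ℕ} (w : Equiv.Perm (Fin n)) (b : Fin n) (j : ℕ) :
    outerExcess w (b + 1) j = outerExcess w b j + shellExcess w b j := by
  have h : ∀ i : Fin n, (if (i : ℕ) < b + 1 then shellExcess w i j else 0) =
      (if (i : ℕ) < b then shellExcess w i j else 0) + if i = b then shellExcess w i j else 0 := by
    intro i
    rcases lt_trichotomy i b with h | h | h
    · have h1 : (i : ℕ) < b := h
      simp [h1, h.ne, h1.trans (Nat.lt_succ_self _)]
    · subst h; simp
    · have h1 : (b : ℕ) < i := h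
      have h2 : ¬ (i : ℕ) < b + 1 := by omega
      simp [h.ne', h1.not_gt, h2]
  simp_rw [outerExcess, h, Finset.sum_add_distrib]
  simp

lemma sum_eq_sum_shell {n : ℕ} (f : Fin n → ℤ) :
    ∑ b, f b = ∑ b : Fin n, if b < b.rev then f b + f b.rev else if b = b.rev then f b else 0 := by
  have h1 : ∑ b : Fin n, f b = (∑ b : Fin n, if b < b.rev then f b else 0) +
      (∑ b : Fin n, if b.rev < b then f b else 0) + ∑ b : Fin n, if b = b.rev then f b else 0 := by
    simp_rw [← Finset.sum_add_distrib]
    refine Finset.sum_congr rfl fun b _ => ?_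
    rcases lt_trichotomy b b.rev with h | h | h
    · simp [h, h.not_gt, h.ne]
    · simp [← h]
    · simp [h, h.not_gt, h.ne']
  have h2 : (∑ b : Fin n, if b.rev < b then f b else 0) =
      ∑ b : Fin n, if b < b.rev then f b.rev else 0 := by
    rw [← Equiv.sum_comp Fin.revPerm]
    simp
  rw [h1, h2]
  simp_rw [← Finset.sum_add_distrib]
  refine Finset.sum_congr rfl fun b _ => ?_
  rcases lt_trichotomy b b.rev with h | h | h
  · simp [h, h.ne]
  · simp [← h]
  · simp [h.not_gt, h.ne']

lemma sum_shell_card (n : ℕ) :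
    (∑ i : Fin n, ((if i < i.rev then (1 : ℤ) else 0) +
      ∑ b : Fin n, if i < b ∧ b < i.rev then (1 : ℤ) else 0)) =
      ((n / 2 : ℕ) : ℤ) * (n - (n / 2 : ℕ)) := by
  have h : ∀ i : Fin n, ((if i < i.rev then (1 : ℤ) else 0) +
      ∑ b : Fin n, if i < b ∧ b < i.rev then (1 : ℤ) else 0) =
      (fun k : ℕ => if k < n / 2 then (n : ℤ) - 1 - 2 * k else 0) i := by
    intro i
    have hc : (∑ b : Fin n, if i < b ∧ b < i.rev then (1 : ℤ) else 0) =
        ((i.rev - i - 1 : ℕ) : ℤ) := by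
      rw [Finset.sum_boole, ← Fin.card_Ioo]
      congr 2
      ext b; simp
    rw [hc]
    have hv := Fin.val_rev i
    simp only [Fin.lt_def]
    split_ifs <;> omega
  rw [Finset.sum_congr rfl fun i _ => h i,
    Fin.sum_univ_eq_sum_range (fun k : ℕ => if k < n / 2 then (n : ℤ) - 1 - 2 * k else 0), ← Finset.sum_filter]
  have hf : (Finset.range n).filter (· < n / 2) = Finset.range (n / 2) := by
    ext k; simp; omega
  rw [hf]
  generalize n / 2 = m
  induction m with
  | zero => simp
  | succ m ih => rw [Finset.sum_range_succ, ih]; push_cast; ring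

lemma invCount_eq_sum_shell {n : ℕ} (w : Equiv.Perm (Fin n)) :
    (invCount n w : ℤ) = ∑ i : Fin n, ((if i < i.rev ∧ w i.rev < w i then (1 : ℤ) else 0) +
      ∑ b : Fin n, if i < b ∧ b < i.rev then
        (if w b < w i then (1 : ℤ) else 0) + (if w i.rev < w b then 1 else 0) else 0) := by
  have h1 : (invCount n w : ℤ) =
      ∑ a : Fin n, ∑ b : Fin n, if a < b ∧ w b < w a then (1 : ℤ) else 0 := by
    rw [invCount, ← Finset.univ_product_univ, Finset.card_filter, Finset.sum_product]
    push_cast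
    rfl
  have h2 : ∀ a b : Fin n, (if a < b ∧ w b < w a then (1 : ℤ) else 0) =
      (if b = a.rev then if a < a.rev ∧ w a.rev < w a then (1 : ℤ) else 0 else 0) +
      (if a < b ∧ b < a.rev then if w b < w a then (1 : ℤ) else 0 else 0) +
      (if b.rev < a ∧ a < b then if w b < w a then (1 : ℤ) else 0 else 0) := by
    intro a b
    have hr : b.rev < a ↔ a.rev < b := Fin.rev_lt_iff
    rcases lt_trichotomy b a.rev with h | h | h
    · simp [hr, h, h.not_gt, h.ne, ite_and]
    · subst h; simp
    · simp [hr, h, h.not_gt, h.ne', ite_and]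
  have h3 : (∑ a : Fin n, ∑ b : Fin n,
      if b.rev < a ∧ a < b then if w b < w a then (1 : ℤ) else 0 else 0) =
      ∑ i : Fin n, ∑ b : Fin n, if i < b ∧ b < i.rev then
        if w i.rev < w b then (1 : ℤ) else 0 else 0 := by
    rw [Finset.sum_comm, ← Equiv.sum_comp Fin.revPerm]
    simp
  rw [h1, Finset.sum_congr rfl fun a _ => Finset.sum_congr rfl fun b _ => h2 a b]
  simp_rw [Finset.sum_add_distrib]
  rw [h3]
  simp only [Finset.sum_ite_eq', Finset.mem_univ, if_true, add_assoc]
  congr 1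
  simp_rw [← Finset.sum_add_distrib]
  refine Finset.sum_congr rfl fun i _ => Finset.sum_congr rfl fun b _ => ?_
  split_ifs <;> simp

/-- The length of `w` is `m(n-m)` plus the sum of the excesses of its shells. -/
lemma invCount_eq {n : ℕ} (w : Equiv.Perm (Fin n)) :
    (invCount n w : ℤ) = ((n / 2 : ℕ) : ℤ) * (n - (n / 2 : ℕ)) + ∑ b, lengthExcess w b := by
  have h1 : ∀ i b : Fin n, (if i < b ∧ b < i.rev then
        (if w b < w i then (1 : ℤ) else 0) + (if w i.rev < w b then 1 else 0) else 0) =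
      (if i < b ∧ b < i.rev then (1 : ℤ) else 0) +
        if (i : ℕ) < min (b : ℕ) (b.rev : ℕ) then shellExcess w i (w b) else 0 := by
    intro i b
    have hiff : (i : ℕ) < min (b : ℕ) (b.rev : ℕ) ↔ i < b ∧ b < i.rev := by
      rw [lt_min_iff, ← Fin.lt_def, ← Fin.lt_def, Fin.lt_rev_iff]
    simp only [hiff]
    by_cases h : i < b ∧ b < i.rev
    · have hne : w b ≠ w i := fun e => h.1.ne' (w.injective e)
      simp only [h, shellExcess, ← Fin.lt_def]
      grind
    · simp [h]
  have h2 : ∀ i : Fin n, (if i < i.rev ∧ w i.rev < w i then (1 : ℤ) else 0) =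
      (if i < i.rev then (1 : ℤ) else 0) -
        if i < i.rev then if w i < w i.rev then (1 : ℤ) else 0 else 0 := by
    intro i
    by_cases h : i < i.rev
    · have hne : w i ≠ w i.rev := fun e => h.ne (w.injective e)
      rcases lt_or_gt_of_ne hne with h' | h' <;> simp [h, h', h'.not_gt]
    · simp [h]
  have h3 : ∑ i : Fin n, ∑ b : Fin n,
      (if (i : ℕ) < min (b : ℕ) (b.rev : ℕ) then shellExcess w i (w b) else 0) =
      ∑ b, positionExcess w b := by
    rw [Finset.sum_comm]; rfl
  rw [invCount_eq_sum_shell, ← sum_shell_card]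
  simp_rw [h1, h2, Finset.sum_add_distrib]
  rw [h3, sum_eq_sum_shell (positionExcess w), Finset.sum_sub_distrib]
  have h4 : ∑ b, lengthExcess w b = (∑ b : Fin n, if b < b.rev then
      positionExcess w b + positionExcess w b.rev else if b = b.rev then
        positionExcess w b else 0) -
      ∑ b : Fin n, if b < b.rev then if w b < w b.rev then (1 : ℤ) else 0 else 0 := by
    rw [← Finset.sum_sub_distrib]
    refine Finset.sum_congr rfl fun b _ => ?_
    simp only [lengthExcess]
    split_ifs <;> simp
  rw [h4]
  ring

/-- The double box contraction condition, stated with `Fin.rev`: no value at an inner position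
lies between the two values of a shell. -/
lemma doubleBox_iff {n : ℕ} (w : Equiv.Perm (Fin n)) : DoubleBox n w ↔
    ∀ i : Fin n, i < i.rev → w i.rev < w i ∧
      ∀ b : Fin n, i < b → b < i.rev → ¬ (w i.rev < w b ∧ w b < w i) := by
  constructor
  · intro h i hi
    have hv := Fin.val_rev i
    have hi' : (i : ℕ) < i.rev := hi
    have hl : n - (i + 1) < n := by omega
    obtain ⟨h1, h2⟩ := h (i + 1) (by omega) (by omega) hl (by omega)
    have e1 : (⟨n - (i + 1), hl⟩ : Fin n) = i.rev := Fin.ext (by simp)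
    simp only [e1, Nat.add_sub_cancel, Fin.eta] at h1 h2
    refine ⟨h1, fun b hb hb' ⟨hc1, hc2⟩ => ?_⟩
    obtain ⟨a, ha1, ha2, ha3⟩ := h2 (w b) hc1 hc2
    have hb1 : (i : ℕ) < b := hb
    have hb2 : (b : ℕ) < i.rev := hb'
    rcases ha3 (by omega) (by omega) with e | e
    · have := congrArg Fin.val (w.injective (Fin.ext e))
      simp at this; omega
    · have := congrArg Fin.val (w.injective (Fin.ext e))
      simp at this; omega
  · intro h i hi1 hi2 hp hq
    have e1 : (⟨i - 1, hq⟩ : Fin n).rev = ⟨n - i, hp⟩ := Fin.ext (by simp; omega)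
    obtain ⟨h1, h2⟩ := h ⟨i - 1, hq⟩ (by rw [e1, Fin.lt_def]; simp; omega)
    rw [e1] at h1 h2
    refine ⟨h1, fun x hx1 hx2 => ?_⟩
    have hxn : x < n := hx2.trans (Fin.is_lt _)
    obtain ⟨b, hb⟩ := w.surjective ⟨x, hxn⟩
    have hbx : (w b : ℕ) = x := by rw [hb]
    have hb1 : (b : ℕ) ≠ i - 1 := fun e => by
      have : b = ⟨i - 1, hq⟩ := Fin.ext e
      rw [← this] at hx2; omega
    have hb2 : (b : ℕ) ≠ n - i := fun e => by
      have : b = ⟨n - i, hp⟩ := Fin.ext e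
      rw [← this] at hx1; omega
    by_cases hlt : (b : ℕ) < i - 1
    · exact ⟨b + 1, by omega, by omega, fun _ _ => Or.inl (by simp [hbx])⟩
    by_cases hgt : n - i < (b : ℕ)
    · refine ⟨n - b, by omega, by omega, fun _ _ => Or.inr ?_⟩
      have : (⟨n - (n - b), by omega⟩ : Fin n) = b := Fin.ext (by simp; omega)
      rw [this, hbx]
    · refine absurd ⟨?_, ?_⟩ (h2 b (by rw [Fin.lt_def]; simp; omega)
        (by rw [Fin.lt_def]; simp; omega))
      · rw [Fin.lt_def]; omega
      · rw [Fin.lt_def]; omega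

lemma lengthExcess_eq_zero_of_doubleBox {n : ℕ} {w : Equiv.Perm (Fin n)} (h : DoubleBox n w)
    (b : Fin n) : lengthExcess w b = 0 := by
  rw [doubleBox_iff] at h
  have hp : ∀ b : Fin n, positionExcess w b = 0 := by
    intro b
    rw [positionExcess, outerExcess]
    refine Finset.sum_eq_zero fun i _ => ?_
    split_ifs with hi
    · rw [lt_min_iff, ← Fin.lt_def, ← Fin.lt_def] at hi
      have hi2 := Fin.lt_rev_iff.1 hi.2
      obtain ⟨h1, h2⟩ := h i (hi.1.trans hi2)
      have h3 := h2 b hi.1 hi2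
      have hne : w b ≠ w i := fun e => hi.1.ne' (w.injective e)
      simp only [shellExcess, ← Fin.lt_def]
      grind
    · rfl
  simp only [lengthExcess, hp]
  split_ifs with h1 h2
  · exact absurd h2 (h b h1).1.not_gt
  all_goals rfl

lemma lengthExcess_nonneg {n : ℕ} {w : Equiv.Perm (Fin n)}
    (h : ∀ s j : ℕ, s ≤ n / 2 → j ≤ n → 0 ≤ outerExcess w s j) (b : Fin n) :
    0 ≤ lengthExcess w b ∧ (lengthExcess w b = 0 → b ≤ b.rev →
      positionExcess w b = 0 ∧ positionExcess w b.rev = 0 ∧ (b < b.rev → w b.rev < w b)) := by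
  have hv := Fin.val_rev b
  have hp : ∀ c : Fin n, 0 ≤ positionExcess w c := fun c =>
    h _ _ (by have := Fin.val_rev c; omega) (w c).is_lt.le
  have h0 := hp b
  have h1 := hp b.rev
  rcases lt_trichotomy b b.rev with hb | hb | hb
  · have hb' : (b : ℕ) < b.rev := hb
    simp only [lengthExcess, hb, if_true]
    have hne : w b ≠ w b.rev := fun e => hb.ne (w.injective e)
    rcases lt_or_gt_of_ne hne with hw | hw
    · have hw' : (w b : ℕ) < w b.rev := hw
      have h2 := h (b + 1) (w b.rev) (by omega) (w b.rev).is_lt.le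
      rw [outerExcess_succ] at h2
      have h3 : shellExcess w b (w b.rev) = -1 := by simp [shellExcess, hw]
      have h4 : positionExcess w b.rev = outerExcess w b (w b.rev) := by
        rw [positionExcess, Fin.rev_rev, min_eq_right hb'.le]
      have h5 := h (b + 1) (w b + 1) (by omega) (w b).is_lt
      rw [outerExcess_succ] at h5
      have h6 : shellExcess w b (w b + 1) = -1 := by
        have : ¬ (w b.rev : ℕ) < w b + 1 := by omega
        simp [shellExcess, this]
      have h7 : positionExcess w b = outerExcess w b (w b + 1) := by
        rw [positionExcess, min_eq_left hb'.le]
        refine Finset.sum_congr rfl fun i _ => ?_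
        split_ifs with hi
        · have hi1 : (w i : ℕ) ≠ w b := fun e => by
            have := w.injective (Fin.ext e); subst this; omega
          have hi2 : (w i.rev : ℕ) ≠ w b := fun e => by
            have := w.injective (Fin.ext e)
            have := congrArg Fin.val this
            rw [Fin.val_rev] at this; omega
          have e1 : (w i : ℕ) < w b + 1 ↔ (w i : ℕ) < w b := by omega
          have e2 : (w i.rev : ℕ) < w b + 1 ↔ (w i.rev : ℕ) < w b := by omega
          simp only [shellExcess, e1, e2]
        · rfl
      simp only [hw, if_true]
      constructor
      · omega
      · intro h8; omega
    · simp only [hw.not_gt, if_false, hw]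
      exact ⟨by omega, fun h8 _ => ⟨by omega, by omega, fun _ => trivial⟩⟩
  · have hl : lengthExcess w b = positionExcess w b := by
      simp only [lengthExcess, ← hb, lt_irrefl, if_false, if_true]
    rw [hl, ← hb]
    exact ⟨h0, fun h8 _ => ⟨h8, h8, fun hlt => absurd hlt (lt_irrefl _)⟩⟩
  · have hl : lengthExcess w b = 0 := by simp [lengthExcess, hb.not_gt, hb.ne']
    exact ⟨hl.ge, fun _ hle => absurd hle hb.not_ge⟩

lemma doubleBox_of_outerExcess_nonneg {n : ℕ} {w : Equiv.Perm (Fin n)}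
    (h : ∀ s j : ℕ, s ≤ n / 2 → j ≤ n → 0 ≤ outerExcess w s j)
    (hl : (invCount n w : ℤ) = ((n / 2 : ℕ) : ℤ) * (n - (n / 2 : ℕ))) : DoubleBox n w := by
  have hsum : ∑ b, lengthExcess w b = 0 := by
    have := invCount_eq w; omega
  have hz := (Finset.sum_eq_zero_iff_of_nonneg fun b _ => (lengthExcess_nonneg h b).1).1 hsum
  have hsp : ∀ i : Fin n, i < i.rev → w i.rev < w i := fun i hi =>
    ((lengthExcess_nonneg h i).2 (hz i (Finset.mem_univ _)) hi.le).2.2 hi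
  have hp : ∀ b : Fin n, positionExcess w b = 0 := by
    intro b
    rcases le_total b b.rev with hb | hb
    · exact ((lengthExcess_nonneg h b).2 (hz b (Finset.mem_univ _)) hb).1
    · have := ((lengthExcess_nonneg h b.rev).2 (hz _ (Finset.mem_univ _)) (by simpa using hb)).2.1
      rwa [Fin.rev_rev] at this
  rw [doubleBox_iff]
  refine fun i hi => ⟨hsp i hi, fun b hb hb' ⟨hc1, hc2⟩ => ?_⟩
  have hnn : ∀ k ∈ (Finset.univ : Finset (Fin n)), 0 ≤ (if (k : ℕ) < min (b : ℕ) (b.rev : ℕ) then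
      shellExcess w k (w b) else 0) := by
    intro k _
    split_ifs with hk
    · rw [lt_min_iff, ← Fin.lt_def, ← Fin.lt_def] at hk
      have h1 := hsp k (hk.1.trans (Fin.lt_rev_iff.1 hk.2))
      simp only [shellExcess, ← Fin.lt_def]
      grind
    · exact le_rfl
  have h0 := (Finset.sum_eq_zero_iff_of_nonneg hnn).1 (hp b) i (Finset.mem_univ _)
  have hi' : (i : ℕ) < min (b : ℕ) (b.rev : ℕ) := by
    rw [lt_min_iff, ← Fin.lt_def, ← Fin.lt_def]
    exact ⟨hb, Fin.lt_rev_iff.2 hb'⟩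
  rw [if_pos hi'] at h0
  simp [shellExcess, hc1, hc2.not_gt] at h0

lemma outerExcess_nonneg {n : ℕ} {w : Equiv.Perm (Fin n)} {F : CompleteFlag n}
    (hF : InSchubert n w F) (hiso : IsotropicFlag n F) (s j : ℕ) (hs : s ≤ n / 2) (hj : j ≤ n) :
    0 ≤ outerExcess w s j := by
  rcases Nat.eq_zero_or_pos s with rfl | hs0
  · simp [outerExcess]
  rcases Nat.eq_zero_or_pos j with rfl | hj0
  · simp [outerExcess, shellExcess]
  have h1 := hF s j hs0 (by omega) hj0 hj (by omega)
  have h2 := hF (n - s) j (by omega) (by omega) hj0 hj (by omega)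
  rw [hiso s hs0 hs (by omega) (by omega)] at h2
  have h3 := finrank_inf_stdE_add_le (F.V ⟨s, by omega⟩) hj
  have hcount : (Finset.univ.filter (fun a : Fin n => (w a : ℕ) < j)).card = j := by
    have e : (Finset.univ.filter (fun a : Fin n => (a : ℕ) < j)).card = j := by
      rw [Fin.card_filter_val_lt, min_eq_right hj]
    refine Eq.trans ?_ e
    refine Finset.card_bij (fun a _ => w a) (by simp) (fun _ _ _ _ e => w.injective e) ?_
    intro b hb
    exact ⟨w.symm b, by simpa using hb, by simp⟩
  have h4 := Finset.card_filter_add_card_filter_not (s := Finset.univ.filter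
    (fun a : Fin n => (w a : ℕ) < j)) (fun a : Fin n => (a : ℕ) < n - s)
  rw [hcount, Finset.filter_filter, Finset.filter_filter] at h4
  have h5 : (Finset.univ.filter (fun a : Fin n => (w a : ℕ) < j ∧ (a : ℕ) < n - s)).card =
      (Finset.univ.filter (fun a : Fin n => (a : ℕ) < n - s ∧ (w a : ℕ) < j)).card := by
    simp_rw [and_comm]
  have h6 : (Finset.univ.filter (fun a : Fin n => (w a : ℕ) < j ∧ ¬ (a : ℕ) < n - s)).card =
      (Finset.univ.filter (fun a : Fin n => (a : ℕ) < s ∧ (w a.rev : ℕ) < j)).card := by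
    refine Finset.card_bij (fun a _ => a.rev) ?_ (fun _ _ _ _ e => Fin.rev_injective e) ?_
    · intro a ha
      simp only [Finset.mem_filter, Finset.mem_univ, true_and, Fin.rev_rev, Fin.val_rev] at ha ⊢
      omega
    · intro a ha
      refine ⟨a.rev, ?_, Fin.rev_rev a⟩
      simp only [Finset.mem_filter, Finset.mem_univ, true_and, Fin.val_rev] at ha ⊢
      omega
  have h7 : outerExcess w s j =
      ((Finset.univ.filter (fun a : Fin n => (a : ℕ) < s ∧ (w a.rev : ℕ) < j)).card : ℤ) -
      ((Finset.univ.filter (fun a : Fin n => (a : ℕ) < s ∧ (w a : ℕ) < j)).card : ℤ) := by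
    rw [← Finset.sum_boole, ← Finset.sum_boole, ← Finset.sum_sub_distrib]
    refine Finset.sum_congr rfl fun i _ => ?_
    by_cases hi : (i : ℕ) < s <;> simp [hi, shellExcess]
  rw [h7]
  omega

/-- The Schubert variety `S_w` contains an isotropic complete flag and
`ℓ(w) = m²` (case `n = 2m`) resp. `ℓ(w) = m² + m` (case `n = 2m+1`), iff `w` satisfies the
double box contraction condition, where `m = ⌊n/2⌋`. -/
theorem isotropic_in_schubert_and_length_iff_doubleBox
    (n : ℕ) (hn : 0 < n) (w : Equiv.Perm (Fin n)) :
    ((∃ F : CompleteFlag n, InSchubert n w F ∧ IsotropicFlag n F) ∧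
        (n = 2 * (n / 2) → invCount n w = (n / 2) ^ 2) ∧
        (n = 2 * (n / 2) + 1 → invCount n w = (n / 2) ^ 2 + n / 2)) ↔
      DoubleBox n w := by
  have hlen : ((n = 2 * (n / 2) → invCount n w = (n / 2) ^ 2) ∧
      (n = 2 * (n / 2) + 1 → invCount n w = (n / 2) ^ 2 + n / 2)) ↔
      (invCount n w : ℤ) = ((n / 2 : ℕ) : ℤ) * (n - (n / 2 : ℕ)) := by
    generalize hm : n / 2 = m
    rcases (by omega : n = 2 * m ∨ n = 2 * m + 1) with h | h
    · have e : (m : ℤ) * (n - m) = ((m ^ 2 : ℕ) : ℤ) := by rw [h]; push_cast; ring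
      rw [e, Nat.cast_inj]
      exact ⟨fun h' => h'.1 h, fun h' => ⟨fun _ => h', fun h'' => by omega⟩⟩
    · have e : (m : ℤ) * (n - m) = ((m ^ 2 + m : ℕ) : ℤ) := by rw [h]; push_cast; ring
      rw [e, Nat.cast_inj]
      exact ⟨fun h' => h'.2 h, fun h' => ⟨fun h'' => by omega, fun _ => h'⟩⟩
  rw [hlen]
  constructor
  · rintro ⟨⟨F, hF, hiso⟩, hl⟩
    exact doubleBox_of_outerExcess_nonneg (outerExcess_nonneg hF hiso) hl
  · intro h
    refine ⟨⟨isoFlag w, isoFlag_inSchubert fun a ha => ((doubleBox_iff w).1 h a ha).1,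
      isoFlag_isotropic w⟩, ?_⟩
    rw [invCount_eq, Finset.sum_eq_zero fun b _ => lengthExcess_eq_zero_of_doubleBox h b, add_zero]
end
end

section
/- Let n be a positive integer, m = ⌊n/2⌋, and let w be a permutation of {1,…,n} satisfying the double box contraction condition. Then the number of isotropic complete flags contained in the Schubert variety S_w is exactly 2^m. -/
noncomputable section

section CoordinateSubspaces

variable {n : ℕ}

/-- The subspace of `ℂ^n` spanned by the standard basis vectors with index in `S`. -/
def coordSub (S : Set (Fin n)) : Submodule ℂ (Fin n → ℂ) :=
  Submodule.span ℂ ((fun i : Fin n => (Pi.single i 1 : Fin n → ℂ)) '' S)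

lemma coordSub_eq_span_basisFun (S : Set (Fin n)) :
    coordSub S = Submodule.span ℂ (Pi.basisFun ℂ (Fin n) '' S) := by
  unfold coordSub
  congr 1
  ext x
  simp

lemma mem_coordSub {S : Set (Fin n)} {x : Fin n → ℂ} :
    x ∈ coordSub S ↔ ∀ i, i ∉ S → x i = 0 := by
  rw [coordSub_eq_span_basisFun, Module.Basis.mem_span_image]
  constructor
  · intro h i hi
    by_contra hx
    exact hi (h (by simpa using hx))
  · intro h i hi
    by_contra hS
    simp [h i hS] at hi

lemma mem_stdE {j : ℕ} {x : Fin n → ℂ} : x ∈ stdE n j ↔ ∀ i : Fin n, j ≤ i → x i = 0 := by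
  have h : stdE n j = coordSub {i : Fin n | (i : ℕ) < j} := rfl
  rw [h, mem_coordSub]
  simp

lemma finrank_coordSub (p : Fin n → Prop) [DecidablePred p] :
    Module.finrank ℂ (coordSub {i | p i}) = (Finset.univ.filter p).card := by
  have hli : LinearIndependent ℂ
      (fun i : (Finset.univ.filter p : Finset (Fin n)) => Pi.basisFun ℂ (Fin n) i) :=
    (Pi.basisFun ℂ (Fin n)).linearIndependent.comp _ Subtype.val_injective
  have h := finrank_span_eq_card hli
  rw [Fintype.card_coe] at h
  have hrange : Pi.basisFun ℂ (Fin n) '' {i | p i} = Set.range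
      (fun i : (Finset.univ.filter p : Finset (Fin n)) => Pi.basisFun ℂ (Fin n) i) := by
    ext x
    simp
  rw [coordSub_eq_span_basisFun, hrange, h]

end CoordinateSubspaces

section TwistedCoordinates

variable {n : ℕ}

/-- `s` assigns a square root of `-1` to each index in the first half, and `0` to the others. -/
structure IsSigns (s : Fin n → ℂ) : Prop where
  sq : ∀ a : Fin n, (a : ℕ) < n / 2 → s a * s a = -1
  zero : ∀ a : Fin n, n / 2 ≤ (a : ℕ) → s a = 0

lemma IsSigns.mul_rev {s : Fin n → ℂ} (hs : IsSigns s) (a : Fin n) : s a * s a.rev = 0 := by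
  rcases lt_or_ge (a : ℕ) (n / 2) with h | h
  · rw [hs.zero a.rev (by rw [Fin.val_rev]; omega), mul_zero]
  · rw [hs.zero a h, zero_mul]

lemma IsSigns.lt_of_ne_zero {s : Fin n → ℂ} (hs : IsSigns s) {a : Fin n} (ha : s a ≠ 0) :
    (a : ℕ) < n / 2 := by
  by_contra h
  exact ha (hs.zero a (not_lt.mp h))

/-- The linear map sending the `a`-th standard basis vector to `e_{w(a)} + s_a e_{w(n+1-a)}`. -/
def twist (w : Equiv.Perm (Fin n)) (s : Fin n → ℂ) : (Fin n → ℂ) →ₗ[ℂ] (Fin n → ℂ) where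
  toFun g := fun x => g (w.symm x) + s (w.symm x).rev * g (w.symm x).rev
  map_add' g h := by
    funext x
    simp only [Pi.add_apply]
    ring
  map_smul' c g := by
    funext x
    simp only [Pi.smul_apply, smul_eq_mul, RingHom.id_apply]
    ring

variable {w : Equiv.Perm (Fin n)} {s : Fin n → ℂ}

@[simp] lemma twist_apply (g : Fin n → ℂ) (c : Fin n) :
    twist w s g (w c) = g c + s c.rev * g c.rev := by
  simp [twist]

lemma eq_twist_iff (hs : IsSigns s) {x g : Fin n → ℂ} :
    x = twist w s g ↔ ∀ c, g c = x (w c) - s c.rev * x (w c.rev) := by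
  constructor
  · rintro rfl c
    have := hs.mul_rev c
    simp only [twist_apply, Fin.rev_rev]
    linear_combination (g c) * this
  · intro h
    funext y
    obtain ⟨c, rfl⟩ := w.surjective y
    have := hs.mul_rev c
    rw [twist_apply, h c, h c.rev, Fin.rev_rev]
    linear_combination (x (w c)) * this

lemma twist_injective (hs : IsSigns s) : Function.Injective (twist w s) := by
  intro g h hgh
  funext c
  rw [(eq_twist_iff (w := w) hs).1 (rfl : twist w s g = _) c,
    (eq_twist_iff (w := w) hs).1 (rfl : twist w s h = _) c, hgh]

/-- The span of the first `k` vectors `e_{w(a)} + s_a e_{w(n+1-a)}`. -/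
def twistE (w : Equiv.Perm (Fin n)) (s : Fin n → ℂ) (k : ℕ) : Submodule ℂ (Fin n → ℂ) :=
  (stdE n k).map (twist w s)

lemma mem_twistE (hs : IsSigns s) {k : ℕ} {x : Fin n → ℂ} :
    x ∈ twistE w s k ↔ ∀ c : Fin n, k ≤ c → x (w c) = s c.rev * x (w c.rev) := by
  unfold twistE
  rw [Submodule.mem_map]
  constructor
  · rintro ⟨g, hg, rfl⟩ c hc
    have h := (eq_twist_iff (w := w) hs).1 (rfl : twist w s g = _) c
    rw [mem_stdE.1 hg c hc] at h
    linear_combination -h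
  · intro h
    refine ⟨fun c => x (w c) - s c.rev * x (w c.rev), mem_stdE.2 fun c hc => ?_,
      ((eq_twist_iff hs).2 fun c => rfl).symm⟩
    rw [h c hc, sub_self]

lemma twistE_mono : Monotone (twistE w s) := by
  intro i j hij
  exact Submodule.map_mono fun x hx => mem_stdE.2 fun c hc => mem_stdE.1 hx c (hij.trans hc)

lemma twistE_congr {t : Fin n → ℂ} {k : ℕ} (hst : ∀ a : Fin n, (a : ℕ) < k → s a = t a) :
    twistE w s k = twistE w t k := by
  have h : ∀ g ∈ stdE n k, twist w s g = twist w t g := by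
    intro g hg
    funext y
    obtain ⟨c, rfl⟩ := w.surjective y
    rw [twist_apply, twist_apply]
    rcases lt_or_ge (c.rev : ℕ) k with hc | hc
    · rw [hst _ hc]
    · rw [mem_stdE.1 hg _ hc, mul_zero, mul_zero]
  ext x
  simp only [twistE, Submodule.mem_map]
  constructor
  · rintro ⟨g, hg, rfl⟩
    exact ⟨g, hg, (h g hg).symm⟩
  · rintro ⟨g, hg, rfl⟩
    exact ⟨g, hg, h g hg⟩

lemma finrank_twistE (hs : IsSigns s) {k : ℕ} (hk : k ≤ n) :
    Module.finrank ℂ (twistE w s k) = k := by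
  unfold twistE
  rw [← (Submodule.equivMapOfInjective _ (twist_injective hs) _).finrank_eq]
  refine (finrank_coordSub fun i : Fin n => (i : ℕ) < k).trans ?_
  rw [Fin.card_filter_val_lt, min_eq_right hk]

lemma twist_mem_stdE_iff (hs : IsSigns s)
    (hw : ∀ a : Fin n, (a : ℕ) < n / 2 → w a.rev < w a) {j : ℕ} {g : Fin n → ℂ} :
    twist w s g ∈ stdE n j ↔ ∀ c, j ≤ (w c : ℕ) → g c = 0 := by
  have key : ∀ c : Fin n, j ≤ (w c : ℕ) → s c.rev ≠ 0 → j ≤ (w c.rev : ℕ) := by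
    intro c hc hne
    have h := hw _ (hs.lt_of_ne_zero hne)
    rw [Fin.rev_rev] at h
    exact hc.trans (Fin.lt_def.1 h).le
  rw [mem_stdE]
  constructor
  · intro h c hc
    rw [(eq_twist_iff (w := w) hs).1 (rfl : twist w s g = _) c, h _ hc]
    by_cases hne : s c.rev = 0
    · simp [hne]
    · rw [h _ (key c hc hne)]
      simp
  · intro h y hy
    obtain ⟨c, rfl⟩ := w.surjective y
    rw [twist_apply, h c hy]
    by_cases hne : s c.rev = 0
    · simp [hne]
    · rw [h _ (key c hy hne)]
      simp

lemma finrank_twistE_inf_stdE (hs : IsSigns s)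
    (hw : ∀ a : Fin n, (a : ℕ) < n / 2 → w a.rev < w a) (k j : ℕ) :
    Module.finrank ℂ ↥(twistE w s k ⊓ stdE n j) =
      (Finset.univ.filter (fun a : Fin n => (a : ℕ) < k ∧ (w a : ℕ) < j)).card := by
  have h : twistE w s k ⊓ stdE n j =
      (coordSub {a : Fin n | (a : ℕ) < k ∧ (w a : ℕ) < j}).map (twist w s) := by
    ext x
    simp only [twistE, Submodule.mem_inf, Submodule.mem_map]
    constructor
    · rintro ⟨⟨g, hg, rfl⟩, hx⟩
      refine ⟨g, mem_coordSub.2 fun c hc => ?_, rfl⟩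
      by_cases hck : (c : ℕ) < k
      · exact (twist_mem_stdE_iff hs hw).1 hx c (not_lt.1 fun hj => hc ⟨hck, hj⟩)
      · exact mem_stdE.1 hg c (not_lt.1 hck)
    · rintro ⟨g, hg, rfl⟩
      refine ⟨⟨g, mem_stdE.2 fun c hc => ?_, rfl⟩, (twist_mem_stdE_iff hs hw).2 fun c hc => ?_⟩
      · exact mem_coordSub.1 hg c fun h => absurd h.1 (not_lt.2 hc)
      · exact mem_coordSub.1 hg c fun h => absurd h.2 (not_lt.2 hc)
  rw [h, ← (Submodule.equivMapOfInjective _ (twist_injective hs) _).finrank_eq]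
  exact finrank_coordSub _

lemma mem_bOrtho_twistE {k : ℕ} {x : Fin n → ℂ} :
    x ∈ bOrtho n (twistE w s k) ↔
      ∀ a : Fin n, (a : ℕ) < k → x (w a) + s a * x (w a.rev) = 0 := by
  have hsum : ∀ g : Fin n → ℂ,
      ∑ i, x i * twist w s g i = ∑ a, g a * (x (w a) + s a * x (w a.rev)) := by
    intro g
    rw [← Equiv.sum_comp w]
    simp only [twist_apply, mul_add, Finset.sum_add_distrib]
    congr 1
    · exact Finset.sum_congr rfl fun a _ => mul_comm _ _
    · rw [← Equiv.sum_comp Fin.revPerm]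
      refine Finset.sum_congr rfl fun a _ => ?_
      simp only [Fin.revPerm_apply, Fin.rev_rev]
      ring
  constructor
  · intro h a ha
    have h1 := h (twist w s (Pi.single a 1)) (Submodule.mem_map_of_mem (mem_stdE.2 fun c hc => ?_))
    · rw [hsum] at h1
      simpa [Pi.single_apply] using h1
    · rw [Pi.single_eq_of_ne]
      rintro rfl
      omega
  · rintro h _ ⟨g, hg, rfl⟩
    rw [hsum]
    refine Finset.sum_eq_zero fun a _ => ?_
    rcases lt_or_ge (a : ℕ) k with ha | ha
    · rw [h a ha, mul_zero]
    · rw [mem_stdE.1 hg a ha, zero_mul]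

lemma bOrtho_twistE (hs : IsSigns s) {k : ℕ} (hk : k ≤ n / 2) :
    bOrtho n (twistE w s k) = twistE w s (n - k) := by
  ext x
  rw [mem_bOrtho_twistE, mem_twistE hs]
  constructor
  · intro h c hc
    have hlt : (c.rev : ℕ) < k := by rw [Fin.val_rev]; omega
    have h1 := h c.rev hlt
    have h2 := hs.sq c.rev (hlt.trans_le hk)
    rw [Fin.rev_rev] at h1
    linear_combination -s c.rev * h1 + x (w c) * h2
  · intro h a ha
    have h1 := h a.rev (by rw [Fin.val_rev]; omega)
    have h2 := hs.sq a (ha.trans_le hk)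
    rw [Fin.rev_rev] at h1
    linear_combination s a * h1 + x (w a) * h2

end TwistedCoordinates

section Flags

variable {n : ℕ} {w : Equiv.Perm (Fin n)}

lemma CompleteFlag.ext_of_eq {F G : CompleteFlag n}
    (h : ∀ (i : ℕ) (hi : i < n + 1), F.V ⟨i, hi⟩ = G.V ⟨i, hi⟩) : F = G := by
  obtain ⟨V, _, _⟩ := F
  obtain ⟨V', _, _⟩ := G
  have : V = V' := funext fun i => h i i.isLt
  subst this
  rfl

lemma CompleteFlag.V_top (F : CompleteFlag n) (hi : n < n + 1) : F.V ⟨n, hi⟩ = ⊤ := by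
  apply Submodule.eq_top_of_finrank_eq
  rw [F.dim]
  simp

lemma CompleteFlag.V_zero (F : CompleteFlag n) (hi : 0 < n + 1) : F.V ⟨0, hi⟩ = ⊥ := by
  rw [← Submodule.finrank_eq_zero, F.dim]

lemma IsotropicFlag.eq_bOrtho {F : CompleteFlag n} (hF : IsotropicFlag n F) {i : ℕ}
    (hi : i ≤ n / 2) (h1 : n - i < n + 1) (h2 : i < n + 1) :
    F.V ⟨n - i, h1⟩ = bOrtho n (F.V ⟨i, h2⟩) := by
  rcases Nat.eq_zero_or_pos i with rfl | hpos
  · rw [F.V_zero h2]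
    refine (F.V_top (Nat.lt_succ_self n)).trans (eq_top_iff.2 fun x _ v hv => ?_).symm
    rw [(Submodule.mem_bot ℂ).1 hv]
    simp
  · exact hF i hpos hi h1 h2

lemma InSchubert.card_le {F : CompleteFlag n} (hF : InSchubert n w F) (i j : ℕ)
    (hj : j ≤ n) (hi : i < n + 1) :
    (Finset.univ.filter (fun a : Fin n => (a : ℕ) < i ∧ (w a : ℕ) < j)).card
      ≤ Module.finrank ℂ ↥(F.V ⟨i, hi⟩ ⊓ stdE n j) := by
  rcases Nat.eq_zero_or_pos i with rfl | hi0
  · simp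
  rcases Nat.eq_zero_or_pos j with rfl | hj0
  · simp
  exact hF i j hi0 (Nat.lt_succ_iff.1 hi) hj0 hj hi

lemma DoubleBox.rev_lt (h : DoubleBox n w) (a : Fin n) (ha : (a : ℕ) < n / 2) :
    w a.rev < w a := by
  have h1 := (h (a + 1) (by omega) (by omega) (by omega) (by simp)).1
  have e : (⟨n - (a + 1), by omega⟩ : Fin n) = a.rev := rfl
  rw [e] at h1
  exact h1

lemma DoubleBox.exists_of_between (h : DoubleBox n w) (a : Fin n) (ha : (a : ℕ) < n / 2)
    (c : Fin n) (h1 : w a.rev < w c) (h2 : w c < w a) :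
    ∃ b : Fin n, b < a ∧ (c = b ∨ c = b.rev) := by
  obtain ⟨b, hb1, hb2, hb⟩ :=
    (h (a + 1) (by omega) (by omega) (by omega) (by simp)).2 (w c) h1 h2
  have hlt : b - 1 < n := by omega
  have e : (⟨n - b, by omega⟩ : Fin n) = Fin.rev ⟨b - 1, hlt⟩ := by
    ext
    rw [Fin.val_rev]
    simp only
    omega
  refine ⟨⟨b - 1, hlt⟩, Fin.lt_def.2 (by simp only; omega), ?_⟩
  have := hb hlt (by omega)
  rw [e] at this
  exact this.imp (fun h => w.injective (Fin.ext h)) (fun h => w.injective (Fin.ext h))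

/-- The flag of the subspaces `twistE w s k`. -/
def twistFlag (w : Equiv.Perm (Fin n)) (s : Fin n → ℂ) (hs : IsSigns s) : CompleteFlag n where
  V k := twistE w s k
  mono := fun _ _ h => twistE_mono h
  dim k := finrank_twistE hs (Nat.lt_succ_iff.1 k.isLt)

lemma twistFlag_isotropic {s : Fin n → ℂ} (hs : IsSigns s) :
    IsotropicFlag n (twistFlag w s hs) :=
  fun _ _ hi _ _ => (bOrtho_twistE hs hi).symm

lemma twistFlag_inSchubert {s : Fin n → ℂ} (hs : IsSigns s)
    (hw : ∀ a : Fin n, (a : ℕ) < n / 2 → w a.rev < w a) :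
    InSchubert n w (twistFlag w s hs) :=
  fun i j _ _ _ _ _ => (finrank_twistE_inf_stdE hs hw i j).ge

lemma eq_of_twistFlag_eq {s t : Fin n → ℂ} (hs : IsSigns s) (ht : IsSigns t)
    (h : twistFlag w s hs = twistFlag w t ht) : s = t := by
  have hV : ∀ (k : ℕ) (hk : k < n + 1), twistE w s k = twistE w t k := fun k hk =>
    congrArg (fun F : CompleteFlag n => F.V ⟨k, hk⟩) h
  funext a
  rcases lt_or_ge (a : ℕ) (n / 2) with ha | ha
  · have hmem : twist w s (Pi.single a 1) ∈ twistE w s (a + 1) := by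
      refine Submodule.mem_map_of_mem (mem_stdE.2 fun c hc => Pi.single_eq_of_ne ?_ _)
      rintro rfl
      omega
    rw [hV _ (by omega)] at hmem
    have hne : a.rev ≠ a := by
      intro he
      have := congrArg Fin.val he
      rw [Fin.val_rev] at this
      omega
    have h1 := (mem_twistE ht).1 hmem a.rev (by rw [Fin.val_rev]; omega)
    simpa [Pi.single_eq_of_ne hne] using h1
  · rw [hs.zero a ha, ht.zero a ha]

/-- If the first `i` steps of a flag in the Schubert variety agree with `twistE w s`, then the
next step contains a vector outside the previous one supported on `w(i)` and `w(n+1-i)`. -/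
lemma exists_mem_supported (hdb : DoubleBox n w) {F : CompleteFlag n} (hiso : IsotropicFlag n F)
    (hF : InSchubert n w F) {s : Fin n → ℂ} (hs : IsSigns s) (a : Fin n)
    (ha : (a : ℕ) < n / 2) (ha1 : (a : ℕ) < n + 1) (ha2 : (a : ℕ) + 1 < n + 1)
    (hV : F.V ⟨a, ha1⟩ = twistE w s a) :
    ∃ v ∈ F.V ⟨a + 1, ha2⟩, v ≠ 0 ∧ ∀ c, c ≠ a → c ≠ a.rev → v (w c) = 0 := by
  have hw := hdb.rev_lt
  have hrev : (a.rev : ℕ) = n - (a + 1) := Fin.val_rev a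
  have hupper : F.V ⟨n - a, by omega⟩ = twistE w s (n - a) := by
    rw [hiso.eq_bOrtho ha.le _ ha1, hV, bOrtho_twistE hs ha.le]
  have hperp := hiso.eq_bOrtho (i := a + 1) ha (by omega) ha2
  have hlow : F.V ⟨n - (a + 1), by omega⟩ ⊓ stdE n (w a.rev) =
      twistE w s (n - a) ⊓ stdE n (w a.rev) := by
    apply Submodule.eq_of_le_of_finrank_le
    · rw [← hupper]
      exact inf_le_inf_right _ (F.mono (Fin.mk_le_mk.2 (by omega)))
    · rw [finrank_twistE_inf_stdE hs hw]
      refine le_trans (Finset.card_le_card fun c => ?_)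
        (hF.card_le (n - (a + 1)) (w a.rev) (w a.rev).isLt.le (by omega))
      simp only [Finset.mem_filter, Finset.mem_univ, true_and]
      rintro ⟨h1, h2⟩
      refine ⟨?_, h2⟩
      by_contra hc
      have : c = a.rev := Fin.ext (by omega)
      rw [this] at h2
      exact lt_irrefl _ h2
  have hnle : ¬ F.V ⟨a + 1, ha2⟩ ⊓ stdE n (w a + 1) ≤ twistE w s a ⊓ stdE n (w a + 1) := by
    intro hle
    have h1 := (hF.card_le (a + 1) (w a + 1) (w a).isLt ha2).trans (Submodule.finrank_mono hle)
    rw [finrank_twistE_inf_stdE hs hw] at h1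
    refine absurd h1 (not_le.2 (Finset.card_lt_card ⟨fun c => ?_, fun hsub => ?_⟩))
    · simp only [Finset.mem_filter, Finset.mem_univ, true_and]
      exact fun h => ⟨by omega, h.2⟩
    · have := @hsub a (by simp)
      simp at this
  obtain ⟨v', ⟨hv'F, hv'E⟩, hv'U⟩ := SetLike.not_le_iff_exists.1 hnle
  set g : Fin n → ℂ := fun c => if c < a then v' (w c) else 0 with hg
  have hgU : twist w s g ∈ twistE w s a := by
    refine Submodule.mem_map_of_mem (mem_stdE.2 fun c hc => if_neg ?_)
    exact not_lt.2 (Fin.le_def.2 hc)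
  have hgE : twist w s g ∈ stdE n (w a + 1) := by
    refine (twist_mem_stdE_iff hs hw).2 fun c hc => ?_
    simp only [hg]
    split_ifs
    · exact mem_stdE.1 hv'E _ hc
    · rfl
  have hvF : v' - twist w s g ∈ F.V ⟨a + 1, ha2⟩ := by
    refine Submodule.sub_mem _ hv'F (F.mono (a := ⟨a, ha1⟩) (Fin.mk_le_mk.2 (Nat.le_succ _)) ?_)
    rw [hV]
    exact hgU
  have hvE : v' - twist w s g ∈ stdE n (w a + 1) := Submodule.sub_mem _ hv'E hgE
  have hv0 : v' - twist w s g ≠ 0 := by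
    intro h0
    rw [sub_eq_zero] at h0
    exact hv'U ⟨h0 ▸ hgU, hv'E⟩
  have hlt0 : ∀ c : Fin n, c < a → (v' - twist w s g) (w c) = 0 := by
    intro c hc
    rw [Pi.sub_apply, twist_apply, hs.zero c.rev (by rw [Fin.val_rev]; omega)]
    simp [hg, hc]
  generalize v' - twist w s g = v at hvF hvE hv0 hlt0
  have hrev0 : ∀ c : Fin n, c < a → v (w c.rev) = 0 := by
    intro c hc
    have hvU : v ∈ twistE w s (n - a) := by
      rw [← hupper]
      exact F.mono (Fin.mk_le_mk.2 (by omega)) hvF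
    have h1 := (mem_twistE hs).1 hvU c.rev (by rw [Fin.val_rev]; omega)
    rw [h1, Fin.rev_rev, hlt0 c hc, mul_zero]
  refine ⟨v, hvF, hv0, fun c hca hcr => ?_⟩
  by_cases hc1 : c < a
  · exact hlt0 c hc1
  by_cases hc2 : c.rev < a
  · simpa using hrev0 c.rev hc2
  rcases lt_or_ge (w c) (w a.rev) with hc3 | hc3
  · have hmem : (Pi.single (w c) 1 : Fin n → ℂ) ∈ twistE w s (n - a) ⊓ stdE n (w a.rev) := by
      refine ⟨(mem_twistE hs).2 fun d hd => ?_, mem_stdE.2 fun d hd => ?_⟩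
      · have hd1 : d ≠ c := by
          rintro rfl
          exact hc2 (Fin.lt_def.2 (by rw [Fin.val_rev]; omega))
        have hd2 : d.rev ≠ c := by
          rintro rfl
          exact hc1 (Fin.lt_def.2 (by rw [Fin.val_rev]; omega))
        rw [Pi.single_eq_of_ne (w.injective.ne hd1), Pi.single_eq_of_ne (w.injective.ne hd2),
          mul_zero]
      · refine Pi.single_eq_of_ne ?_ _
        rintro rfl
        exact absurd hc3 (not_lt.2 hd)
    rw [← hlow, hperp] at hmem
    simpa [Pi.single_apply] using hmem.1 v hvF
  rcases lt_or_ge (w a) (w c) with hc4 | hc4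
  · exact mem_stdE.1 hvE _ hc4
  obtain ⟨b, hb, rfl | rfl⟩ := hdb.exists_of_between a ha c
    (lt_of_le_of_ne hc3 (w.injective.ne hcr).symm) (lt_of_le_of_ne hc4 (w.injective.ne hca))
  · exact absurd hb hc1
  · exact absurd (by rwa [Fin.rev_rev]) hc2

lemma exists_update_eq_twistE (hdb : DoubleBox n w) {F : CompleteFlag n}
    (hiso : IsotropicFlag n F) (hF : InSchubert n w F) {s : Fin n → ℂ} (hs : IsSigns s)
    (a : Fin n) (ha : (a : ℕ) < n / 2) (ha1 : (a : ℕ) < n + 1) (ha2 : (a : ℕ) + 1 < n + 1)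
    (hV : F.V ⟨a, ha1⟩ = twistE w s a) :
    ∃ z : ℂ, IsSigns (Function.update s a z) ∧
      F.V ⟨a + 1, ha2⟩ = twistE w (Function.update s a z) (a + 1) := by
  obtain ⟨v, hvF, hv0, hsupp⟩ := exists_mem_supported hdb hiso hF hs a ha ha1 ha2 hV
  have hne : a.rev ≠ a := by
    intro he
    have := congrArg Fin.val he
    rw [Fin.val_rev] at this
    omega
  have hvv : v (w a) * v (w a) + v (w a.rev) * v (w a.rev) = 0 := by
    have hmem : v ∈ bOrtho n (F.V ⟨a + 1, ha2⟩) := by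
      rw [← hiso.eq_bOrtho (i := a + 1) ha (by omega) ha2]
      exact F.mono (Fin.mk_le_mk.2 (by omega)) hvF
    have h1 := hmem v hvF
    rw [← Equiv.sum_comp w] at h1
    rw [← h1, ← Finset.sum_pair (f := fun c => v (w c) * v (w c)) hne.symm]
    refine Finset.sum_subset (Finset.subset_univ _) fun c _ hc => ?_
    simp only [Finset.mem_insert, Finset.mem_singleton, not_or] at hc
    rw [hsupp c hc.1 hc.2, mul_zero]
  have hva : v (w a) ≠ 0 := by
    intro h0
    rw [h0, mul_zero, zero_add, mul_self_eq_zero] at hvv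
    apply hv0
    funext y
    obtain ⟨c, rfl⟩ := w.surjective y
    by_cases hca : c = a
    · rw [hca, h0, Pi.zero_apply]
    by_cases hcr : c = a.rev
    · rw [hcr, hvv, Pi.zero_apply]
    exact hsupp c hca hcr
  set z := v (w a.rev) / v (w a) with hz
  have hs' : IsSigns (Function.update s a z) := by
    refine ⟨fun b hb => ?_, fun b hb => ?_⟩
    · by_cases hba : b = a
      · subst hba
        rw [Function.update_self, hz]
        field_simp
        linear_combination hvv
      · rw [Function.update_of_ne hba]
        exact hs.sq b hb
    · rw [Function.update_of_ne (by rintro rfl; omega)]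
      exact hs.zero b hb
  refine ⟨z, hs', (Submodule.eq_of_le_of_finrank_eq ?_ ?_).symm⟩
  · rintro _ ⟨g, hg, rfl⟩
    have hdecomp : g = Function.update g a 0 + (g a / v (w a)) • Pi.single a (v (w a)) := by
      funext c
      by_cases hca : c = a
      · subst hca
        simp [hva]
      · simp [hca]
    have hsingle : twist w (Function.update s a z) (Pi.single a (v (w a))) = v := by
      funext y
      obtain ⟨c, rfl⟩ := w.surjective y
      rw [twist_apply]
      by_cases hca : c = a
      · subst hca
        simp [Pi.single_eq_of_ne hne]
      by_cases hcr : c = a.rev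
      · subst hcr
        simp [Pi.single_eq_of_ne hne, hz, hva]
      · have hcr' : c.rev ≠ a := by
          rintro rfl
          simp at hcr
        rw [hsupp c hca hcr, Pi.single_eq_of_ne hca, Pi.single_eq_of_ne hcr']
        simp
    rw [hdecomp, map_add, map_smul, hsingle]
    refine Submodule.add_mem _ (F.mono (a := ⟨a, ha1⟩) (Fin.mk_le_mk.2 (Nat.le_succ _)) ?_)
      (Submodule.smul_mem _ _ hvF)
    rw [hV, twistE_congr (t := Function.update s a z)]
    · refine Submodule.mem_map_of_mem (mem_stdE.2 fun c hc => ?_)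
      by_cases hca : c = a
      · rw [hca, Function.update_self]
      · rw [Function.update_of_ne hca]
        refine mem_stdE.1 hg c ?_
        have := Fin.val_ne_of_ne hca
        omega
    · intro b hb
      rw [Function.update_of_ne]
      rintro rfl
      exact lt_irrefl _ hb
  · rw [F.dim, finrank_twistE hs' (by omega)]

lemma exists_isSigns (n : ℕ) : ∃ s : Fin n → ℂ, IsSigns s := by
  refine ⟨fun a => if (a : ℕ) < n / 2 then Complex.I else 0, fun a ha => ?_, fun a ha => ?_⟩
  · simp [ha]
  · simp [not_lt.2 ha]

lemma exists_eq_twistE (hdb : DoubleBox n w) {F : CompleteFlag n}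
    (hiso : IsotropicFlag n F) (hF : InSchubert n w F) (i : ℕ) (hi : i ≤ n / 2) :
    ∃ s : Fin n → ℂ, IsSigns s ∧
      ∀ (k : ℕ) (hk : k < n + 1), k ≤ i → F.V ⟨k, hk⟩ = twistE w s k := by
  induction i with
  | zero =>
    obtain ⟨s, hs⟩ := exists_isSigns n
    refine ⟨s, hs, fun k hk hk0 => ?_⟩
    obtain rfl := Nat.le_zero.1 hk0
    rw [F.V_zero hk, eq_comm, ← Submodule.finrank_eq_zero]
    exact finrank_twistE hs (Nat.zero_le n)
  | succ i ih =>
    obtain ⟨s, hs, hk⟩ := ih (by omega)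
    obtain ⟨z, hz, hV⟩ := exists_update_eq_twistE hdb hiso hF hs ⟨i, by omega⟩ hi
      (by simp only; omega) (by simp only; omega) (hk i _ le_rfl)
    refine ⟨_, hz, fun k hkn hki => ?_⟩
    rcases Nat.lt_or_ge i k with hik | hik
    · obtain rfl : k = i + 1 := by omega
      exact hV
    · rw [hk k hkn hik]
      refine twistE_congr fun b hb => ?_
      rw [Function.update_of_ne]
      rintro rfl
      simp only at hb
      omega

lemma exists_eq_twistFlag (hdb : DoubleBox n w) {F : CompleteFlag n}
    (hiso : IsotropicFlag n F) (hF : InSchubert n w F) :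
    ∃ (s : Fin n → ℂ) (hs : IsSigns s), twistFlag w s hs = F := by
  obtain ⟨s, hs, h⟩ := exists_eq_twistE hdb hiso hF (n / 2) le_rfl
  refine ⟨s, hs, CompleteFlag.ext_of_eq fun i hi => ?_⟩
  change twistE w s i = _
  rcases Nat.lt_or_ge (n / 2) i with hlt | hle
  · have hk : n - i ≤ n / 2 := by omega
    obtain ⟨k, rfl⟩ : ∃ k, i = n - k := ⟨n - i, by omega⟩
    by_cases hkn : n < k
    · omega
    · have hk' : k ≤ n / 2 := by omega
      rw [hiso.eq_bOrtho hk' hi (by omega), h k _ hk', bOrtho_twistE hs hk']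
  · exact (h i hi hle).symm

open Classical in
/-- The finite set of sign choices. -/
def signsFinset (n : ℕ) : Finset (Fin n → ℂ) :=
  Fintype.piFinset fun a : Fin n => if (a : ℕ) < n / 2 then {Complex.I, -Complex.I} else {0}

lemma mem_signsFinset {s : Fin n → ℂ} : s ∈ signsFinset n ↔ IsSigns s := by
  have hI : ∀ z : ℂ, z * z = -1 ↔ z = Complex.I ∨ z = -Complex.I := by
    intro z
    rw [← Complex.I_mul_I, mul_self_eq_mul_self_iff]
  rw [signsFinset, Fintype.mem_piFinset]
  constructor
  · intro h
    refine ⟨fun a ha => ?_, fun a ha => ?_⟩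
    · simpa [ha, hI] using h a
    · simpa [not_lt.2 ha] using h a
  · intro h a
    rcases lt_or_ge (a : ℕ) (n / 2) with ha | ha
    · simpa [ha, hI] using h.sq a ha
    · simpa [not_lt.2 ha] using h.zero a ha

lemma card_signsFinset (n : ℕ) : (signsFinset n).card = 2 ^ (n / 2) := by
  have hne : Complex.I ≠ -Complex.I := by
    intro h
    have := self_eq_neg.1 h
    exact Complex.I_ne_zero this
  have hcard : ∀ a : Fin n, (if (a : ℕ) < n / 2 then ({Complex.I, -Complex.I} : Finset ℂ)
      else {0}).card = if (a : ℕ) < n / 2 then 2 else 1 := by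
    intro a
    split_ifs
    · exact Finset.card_pair hne
    · rfl
  rw [signsFinset, Fintype.card_piFinset, Finset.prod_congr rfl fun a _ => hcard a,
    Finset.prod_ite, Finset.prod_const, Finset.prod_const_one, mul_one, Fin.card_filter_val_lt,
    min_eq_right (Nat.div_le_self n 2)]

end Flags

/-- If `w` satisfies the double box contraction condition, then the
number of isotropic complete flags contained in the Schubert variety `S_w`
is exactly `2^{⌊n/2⌋}`. -/
theorem card_isotropic_flags_in_schubert
    (n : ℕ) (hn : 0 < n) (w : Equiv.Perm (Fin n)) (hdb : DoubleBox n w) :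
    Nat.card {F : CompleteFlag n // IsotropicFlag n F ∧ InSchubert n w F}
      = 2 ^ (n / 2) := by
  rw [← card_signsFinset n, ← Fintype.card_coe, ← Nat.card_eq_fintype_card, eq_comm]
  refine Nat.card_eq_of_bijective
    (fun s : signsFinset n => ⟨twistFlag w s (mem_signsFinset.1 s.2), twistFlag_isotropic _,
      twistFlag_inSchubert _ hdb.rev_lt⟩) ⟨fun s t hst => ?_, fun F => ?_⟩
  · exact Subtype.ext (eq_of_twistFlag_eq (mem_signsFinset.1 s.2) (mem_signsFinset.1 t.2)
      (congrArg Subtype.val hst))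
  · obtain ⟨s, hs, h⟩ := exists_eq_twistFlag hdb F.2.1 F.2.2
    exact ⟨⟨s, mem_signsFinset.2 hs⟩, Subtype.ext h⟩
end
end

section
/- Let n ≥ 2, m = ⌊n/2⌋, and let w be a permutation of {1,…,n} satisfying the spacing condition. Then ℓ(w) ≥ m² if n = 2m, and ℓ(w) ≥ m² + m if n = 2m+1. -/
noncomputable section

theorem sum_range_sub_one_sub_two_mul (n m : ℕ) (h : 2 * m ≤ n) :
    ∑ i ∈ Finset.range m, (n - 1 - 2 * i) = m * (n - m) := by
  induction m with
  | zero => simp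
  | succ k ih =>
    rw [Finset.sum_range_succ, ih (by omega)]
    obtain ⟨d, rfl⟩ := Nat.exists_eq_add_of_le h
    have h1 : 2 * (k + 1) + d - k = k + 2 + d := by omega
    have h2 : 2 * (k + 1) + d - 1 - 2 * k = 1 + d := by omega
    have h3 : 2 * (k + 1) + d - (k + 1) = k + 1 + d := by omega
    rw [h1, h2, h3]
    ring

/-- For a position `i` in the first half and a position `k` with `i < k ≤ n + 1 - i`, one of
`(i, k)` and `(k, n + 1 - i)` is an inversion (positions counted from `1`); these inversions are pairwise distinct. -/
theorem Spacing.mul_sub_le_invCount {n : ℕ} {w : Equiv.Perm (Fin n)} (hsp : Spacing n w) :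
    n / 2 * (n - n / 2) ≤ invCount n w := by
  have hrev : ∀ i : Fin n, (i : ℕ) < n / 2 → w i.rev < w i := by
    intro i hi
    have h := hsp (i + 1) (by omega) (by omega) (by omega) (by omega)
    have h1 : (⟨n - (i + 1), by omega⟩ : Fin n) = i.rev := by ext; simp
    rw [h1] at h
    exact h
  let D := (Finset.univ : Finset (Σ i : Fin (n / 2), Fin (n - 1 - 2 * i)))
  have hD : D.card = n / 2 * (n - n / 2) := by
    simp only [D, Finset.card_univ, Fintype.card_sigma, Fintype.card_fin]
    rw [Fin.sum_univ_eq_sum_range (fun i => n - 1 - 2 * i),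
      sum_range_sub_one_sub_two_mul _ _ (by omega)]
  let I : (Σ i : Fin (n / 2), Fin (n - 1 - 2 * i)) → Fin n := fun x => ⟨x.1, by omega⟩
  let K : (Σ i : Fin (n / 2), Fin (n - 1 - 2 * i)) → Fin n :=
    fun x => ⟨x.1 + 1 + x.2, by omega⟩
  let f : (Σ i : Fin (n / 2), Fin (n - 1 - 2 * i)) → Fin n × Fin n :=
    fun x => if w (K x) < w (I x) then (I x, K x) else (K x, (I x).rev)
  rw [← hD, invCount]
  refine Finset.card_le_card_of_injOn f ?_ ?_
  · intro x _
    have hI : w (I x).rev < w (I x) := hrev (I x) x.1.2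
    have hIK : I x < K x := by
      simp only [I, K, Fin.mk_lt_mk]
      omega
    simp only [Finset.coe_filter, Finset.mem_univ, true_and, Set.mem_ofPred_eq, f]
    split_ifs with h
    · exact ⟨hIK, h⟩
    · refine ⟨lt_of_le_of_ne ?_ ?_, hI.trans_le (not_lt.mp h)⟩
      · simp only [I, K, Fin.le_def, Fin.val_rev]
        omega
      · intro he
        exact h ((congrArg w he).trans_lt hI)
  · rintro ⟨⟨i, hi⟩, ⟨s, hs⟩⟩ _ ⟨⟨j, hj⟩, ⟨t, ht⟩⟩ _ hf
    have key : i = j ∧ s = t := by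
      simp only [f] at hf
      simp only at hs ht
      split_ifs at hf <;>
      · simp only [I, K, Prod.mk.injEq, Fin.ext_iff, Fin.val_rev] at hf
        omega
    obtain ⟨rfl, rfl⟩ := key
    rfl

/-- If `n ≥ 2` and `w` satisfies the spacing condition, then
`ℓ(w) ≥ m²` if `n = 2m` and `ℓ(w) ≥ m² + m` if `n = 2m+1`, where `m = ⌊n/2⌋`. -/
theorem spacing_length_lower_bound
    (n : ℕ) (hn : 2 ≤ n) (w : Equiv.Perm (Fin n)) (hsp : Spacing n w) :
    (n = 2 * (n / 2) → (n / 2) ^ 2 ≤ invCount n w) ∧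
      (n = 2 * (n / 2) + 1 → (n / 2) ^ 2 + n / 2 ≤ invCount n w) := by
  have h := hsp.mul_sub_le_invCount
  constructor <;> intro hm
  · have hs : n - n / 2 = n / 2 := by omega
    rwa [hs, ← sq] at h
  · have hs : n - n / 2 = n / 2 + 1 := by omega
    rwa [hs, mul_add, mul_one, ← sq] at h
end
end
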